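/- arXiv:1703.02820 — 4 statements merged into one kernel-verified Lean document; each statement's English description precedes it below -/
import Mathlib

section
/- For every x ∈ [0,1), f(x) = x/2 + (3/2)·f02(x). -/
/-- The `n`-th ternary digit of `x` (n = 0,1,2,...). -/
noncomputable def terDigit (n : ℕ) (x : ℝ) : ℤ := ⌊(3:ℝ)^(n+1) * x⌋ % 3

/-- φ(i) = (−3i² + 7i)/2, so φ(0)=0, φ(1)=2, φ(2)=1. -/
noncomputable def phi (i : ℤ) : ℝ := (-3*(i:ℝ)^2 + 7*(i:ℝ))/2

/-- φ01(i) = (i² − i)/2. -/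
noncomputable def phi01 (i : ℤ) : ℝ := ((i:ℝ)^2 - (i:ℝ))/2

/-- φ02(i) = −i² + 2i. -/
noncomputable def phi02 (i : ℤ) : ℝ := -(i:ℝ)^2 + 2*(i:ℝ)

/-- φ12(i) = (i² − 3i + 2)/2. -/
noncomputable def phi12 (i : ℤ) : ℝ := ((i:ℝ)^2 - 3*(i:ℝ) + 2)/2

/-- f(x) = ∑ φ(d_n(x))/3^(n+1). -/
noncomputable def f (x : ℝ) : ℝ := ∑' n : ℕ, phi (terDigit n x) / 3^(n+1)

noncomputable def f01 (x : ℝ) : ℝ := ∑' n : ℕ, phi01 (terDigit n x) / 3^(n+1)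

noncomputable def f02 (x : ℝ) : ℝ := ∑' n : ℕ, phi02 (terDigit n x) / 3^(n+1)

noncomputable def f12 (x : ℝ) : ℝ := ∑' n : ℕ, phi12 (terDigit n x) / 3^(n+1)

/-- `x` is ternary-irrational: `3^n x` is never an integer. -/
def TernaryIrrational (x : ℝ) : Prop := ∀ n : ℕ, ¬ ∃ k : ℤ, (3:ℝ)^n * x = (k:ℝ)

theorem terDigit_eq_digits {x : ℝ} (hx : 0 ≤ x) (n : ℕ) :
    terDigit n x = ((Real.digits x 3 n : ℕ) : ℤ) := by
  have h : ⌊(3:ℝ)^(n+1) * x⌋ = (⌊x * (3:ℝ)^(n+1)⌋₊ : ℤ) := by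
    rw [mul_comm, Int.natCast_floor_eq_floor (by positivity)]
  simp [terDigit, Real.digits, h]

theorem hasSum_terDigit {x : ℝ} (hx : x ∈ Set.Ico (0:ℝ) 1) :
    HasSum (fun n : ℕ ↦ (terDigit n x : ℝ) / 3^(n+1)) x := by
  convert! Real.hasSum_ofDigitsTerm_digits x (b := 3) (by norm_num) hx using 2 with n
  simp [terDigit_eq_digits hx.1, Real.ofDigitsTerm, div_eq_mul_inv]

theorem phi02_nonneg_le_one (m : ℤ) : 0 ≤ phi02 (m % 3) ∧ phi02 (m % 3) ≤ 1 := by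
  obtain h | h | h : m % 3 = 0 ∨ m % 3 = 1 ∨ m % 3 = 2 := by lia
  all_goals rw [h]; norm_num [phi02]

theorem summable_phi02_terDigit (x : ℝ) :
    Summable (fun n : ℕ ↦ phi02 (terDigit n x) / 3^(n+1)) := by
  have hgeom : Summable (fun n : ℕ ↦ (1 / 3 : ℝ)^(n+1)) :=
    (summable_nat_add_iff 1).2 (summable_geometric_of_lt_one (by norm_num) (by norm_num))
  refine hgeom.of_nonneg_of_le (fun n ↦ ?_) (fun n ↦ ?_)
  · exact div_nonneg (phi02_nonneg_le_one _).1 (by positivity)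
  · rw [div_pow, one_pow]
    gcongr
    exact (phi02_nonneg_le_one _).2

theorem phi_eq_half_add_phi02 (i : ℤ) : phi i = (i : ℝ) / 2 + 3 / 2 * phi02 i := by
  simp only [phi, phi02]
  ring

theorem stmt_2 : ∀ x ∈ Set.Ico (0:ℝ) 1, f x = x/2 + (3/2) * f02 x := by
  intro x hx
  have h := ((hasSum_terDigit hx).div_const 2).add
    ((summable_phi02_terDigit x).hasSum.mul_left (3 / 2))
  refine Eq.trans (tsum_congr fun n ↦ ?_) h.tsum_eq
  rw [phi_eq_half_add_phi02]
  ring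
end

section
/- For every ternary-irrational x ∈ (0,1), f(x) + f(1 − x) = 1/2 + 3·f02(x). -/
theorem terDigit_mem (n : ℕ) (x : ℝ) :
    terDigit n x = 0 ∨ terDigit n x = 1 ∨ terDigit n x = 2 := by
  unfold terDigit
  omega

theorem terDigit_one_sub {x : ℝ} (hx : TernaryIrrational x) (n : ℕ) :
    terDigit n (1 - x) = 2 - terDigit n x := by
  have hfloor : ⌊(3:ℝ)^(n+1) * (1 - x)⌋ = 3 * 3^n - 1 - ⌊(3:ℝ)^(n+1) * x⌋ := by
    have hle := Int.floor_le ((3:ℝ)^(n+1) * x)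
    have hlt := Int.lt_floor_add_one ((3:ℝ)^(n+1) * x)
    have hne : (⌊(3:ℝ)^(n+1) * x⌋ : ℝ) ≠ 3^(n+1) * x := fun h => hx (n+1) ⟨_, h.symm⟩
    have hlt' := lt_of_le_of_ne hle hne
    have hpow : (3:ℝ)^(n+1) = 3 * 3^n := pow_succ' 3 n
    rw [Int.floor_eq_iff]
    push_cast
    constructor <;> linarith
  unfold terDigit
  rw [hfloor]
  omega

theorem phi_add_phi_two_sub {d : ℤ} (hd : d = 0 ∨ d = 1 ∨ d = 2) :
    phi d + phi (2 - d) = 1 + 3 * phi02 d := by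
  rcases hd with rfl | rfl | rfl <;> norm_num [phi, phi02]

theorem hasSum_inv_three_pow_succ : HasSum (fun n : ℕ => (1:ℝ) / 3^(n+1)) (1/2) := by
  have h := (hasSum_geometric_of_lt_one (r := (1/3:ℝ)) (by norm_num) (by norm_num)).mul_left (1/3)
  have hval : (1/3:ℝ) * (1 - 1/3)⁻¹ = 1/2 := by norm_num
  rw [hval] at h
  simp_rw [← pow_succ', one_div_pow] at h
  exact h

theorem summable_terDigit_series (g : ℤ → ℝ) (x : ℝ) :
    Summable fun n : ℕ => g (terDigit n x) / 3^(n+1) := by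
  refine Summable.of_norm_bounded
    (hasSum_inv_three_pow_succ.summable.mul_left (|g 0| + |g 1| + |g 2|)) fun n => ?_
  have hpos : (0:ℝ) < 3^(n+1) := by positivity
  rw [Real.norm_eq_abs, abs_div, abs_of_pos hpos, mul_one_div]
  gcongr
  have h0 := abs_nonneg (g 0)
  have h1 := abs_nonneg (g 1)
  have h2 := abs_nonneg (g 2)
  rcases terDigit_mem n x with h | h | h <;> rw [h] <;> linarith

theorem stmt_6 : ∀ x ∈ Set.Ioo (0:ℝ) 1, TernaryIrrational x →
    f x + f (1 - x) = 1/2 + 3 * f02 x := by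
  intro x _ hx
  unfold f f02
  rw [← (summable_terDigit_series phi x).tsum_add (summable_terDigit_series phi (1 - x)),
    ← hasSum_inv_three_pow_succ.tsum_eq, ← tsum_mul_left,
    ← hasSum_inv_three_pow_succ.summable.tsum_add
      ((summable_terDigit_series phi02 x).mul_left 3)]
  refine tsum_congr fun n => ?_
  rw [terDigit_one_sub hx, ← add_div, phi_add_phi_two_sub (terDigit_mem n x)]
  ring
end

section
/- The function f is decreasing (in the non-strict sense) on sets of points whose ternary representations agree up to some position and then have digit 1 versus digit 2: if x₁, x₂ ∈ [0,1), n₀ ∈ ℕ, d_m(x₁) = d_m(x₂) for all m < n₀, d_{n₀}(x₁) = 1 and d_{n₀}(x₂) = 2, then x₁ < x₂ and f(x₁) ≥ f(x₂). -/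
theorem phi_terDigit_nonneg (n : ℕ) (x : ℝ) : 0 ≤ phi (terDigit n x) := by
  rcases terDigit_mem n x with h | h | h <;> rw [h, phi] <;> norm_num

theorem phi_terDigit_le_two (n : ℕ) (x : ℝ) : phi (terDigit n x) ≤ 2 := by
  rcases terDigit_mem n x with h | h | h <;> rw [h, phi] <;> norm_num

theorem floor_three_pow_succ_mul (n : ℕ) (x : ℝ) :
    ⌊(3 : ℝ) ^ (n + 1) * x⌋ = 3 * ⌊(3 : ℝ) ^ n * x⌋ + terDigit n x := by
  have hlow : 3 * ⌊(3 : ℝ) ^ n * x⌋ ≤ ⌊(3 : ℝ) ^ (n + 1) * x⌋ := by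
    rw [Int.le_floor, pow_succ]
    push_cast
    linarith [Int.floor_le ((3 : ℝ) ^ n * x)]
  have hupp : ⌊(3 : ℝ) ^ (n + 1) * x⌋ < 3 * ⌊(3 : ℝ) ^ n * x⌋ + 3 := by
    rw [Int.floor_lt, pow_succ]
    push_cast
    linarith [Int.lt_floor_add_one ((3 : ℝ) ^ n * x)]
  unfold terDigit
  omega

theorem floor_three_pow_mul_eq_of_terDigit_eq {x y : ℝ} (hx : x ∈ Set.Ico (0 : ℝ) 1)
    (hy : y ∈ Set.Ico (0 : ℝ) 1) (n : ℕ) (h : ∀ m < n, terDigit m x = terDigit m y) :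
    ⌊(3 : ℝ) ^ n * x⌋ = ⌊(3 : ℝ) ^ n * y⌋ := by
  induction n with
  | zero => simp [Int.floor_eq_zero_iff.2 hx, Int.floor_eq_zero_iff.2 hy]
  | succ n ih =>
    rw [floor_three_pow_succ_mul, floor_three_pow_succ_mul, h n n.lt_succ_self,
      ih fun m hm => h m (hm.trans n.lt_succ_self)]

theorem hasSum_two_div_three_pow (k : ℕ) :
    HasSum (fun n : ℕ => (2 : ℝ) / 3 ^ (n + k + 1)) (1 / 3 ^ k) := by
  have h := (hasSum_geometric_of_lt_one (r := (1 / 3 : ℝ)) (by norm_num) (by norm_num)).mul_left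
    (2 / 3 ^ (k + 1) : ℝ)
  have hterm : (fun n : ℕ => (2 : ℝ) / 3 ^ (n + k + 1)) =
      fun n => 2 / 3 ^ (k + 1) * (1 / 3 : ℝ) ^ n := by
    funext n
    rw [one_div, inv_pow, ← div_eq_mul_inv, div_div, ← pow_add]
    congr 2
    omega
  have htotal : (1 : ℝ) / 3 ^ k = 2 / 3 ^ (k + 1) * (1 - 1 / 3)⁻¹ := by
    rw [pow_succ]
    field_simp
    norm_num
  rwa [hterm, htotal]

theorem summable_phi_terDigit (x : ℝ) :
    Summable fun n : ℕ => phi (terDigit n x) / 3 ^ (n + 1) :=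
  (hasSum_two_div_three_pow 0).summable.of_nonneg_of_le
    (fun n => div_nonneg (phi_terDigit_nonneg n x) (by positivity))
    (fun n => div_le_div_of_nonneg_right (phi_terDigit_le_two n x) (by positivity))

theorem sum_range_phi_le_f (k : ℕ) (x : ℝ) :
    ∑ n ∈ Finset.range k, phi (terDigit n x) / 3 ^ (n + 1) ≤ f x :=
  (summable_phi_terDigit x).sum_le_tsum _
    fun n _ => div_nonneg (phi_terDigit_nonneg n x) (by positivity)

theorem f_le_sum_range_phi_add (k : ℕ) (x : ℝ) :
    f x ≤ ∑ n ∈ Finset.range k, phi (terDigit n x) / 3 ^ (n + 1) + 1 / 3 ^ k := by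
  have hs := summable_phi_terDigit x
  rw [f, ← hs.sum_add_tsum_nat_add k, ← (hasSum_two_div_three_pow k).tsum_eq]
  gcongr with n
  · exact (summable_nat_add_iff k).2 hs
  · exact (hasSum_two_div_three_pow k).summable
  · exact phi_terDigit_le_two _ x

theorem stmt_10 (x₁ x₂ : ℝ) (hx₁ : x₁ ∈ Set.Ico (0:ℝ) 1) (hx₂ : x₂ ∈ Set.Ico (0:ℝ) 1)
    (n₀ : ℕ) (hagree : ∀ m < n₀, terDigit m x₁ = terDigit m x₂)
    (h1 : terDigit n₀ x₁ = 1) (h2 : terDigit n₀ x₂ = 2) :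
    x₁ < x₂ ∧ f x₁ ≥ f x₂ := by
  constructor
  · have hfloor : ⌊(3 : ℝ) ^ (n₀ + 1) * x₁⌋ < ⌊(3 : ℝ) ^ (n₀ + 1) * x₂⌋ := by
      rw [floor_three_pow_succ_mul, floor_three_pow_succ_mul, h1, h2,
        floor_three_pow_mul_eq_of_terDigit_eq hx₁ hx₂ n₀ hagree]
      omega
    by_contra! h
    exact hfloor.not_ge (Int.floor_le_floor (by gcongr))
  · have hlow := sum_range_phi_le_f (n₀ + 1) x₁
    have hupp := f_le_sum_range_phi_add (n₀ + 1) x₂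
    have hprefix : ∑ n ∈ Finset.range n₀, phi (terDigit n x₁) / 3 ^ (n + 1) =
        ∑ n ∈ Finset.range n₀, phi (terDigit n x₂) / 3 ^ (n + 1) :=
      Finset.sum_congr rfl fun n hn => by rw [hagree n (Finset.mem_range.1 hn)]
    have hphi1 : phi 1 = 2 := by norm_num [phi]
    have hphi2 : phi 2 = 1 := by norm_num [phi]
    rw [Finset.sum_range_succ, h1, hphi1, hprefix] at hlow
    rw [Finset.sum_range_succ, h2, hphi2] at hupp
    have htwo : (2 : ℝ) / 3 ^ (n₀ + 1) = 1 / 3 ^ (n₀ + 1) + 1 / 3 ^ (n₀ + 1) := by ring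
    linarith
end

section
/- Every ternary-rational point of (0,1) is a jump discontinuity of f, with explicit jump: let n ≥ 1, x ∈ (0,1) with 3^n·x ∈ ℤ, and suppose the last ternary digit of x is at position n−1, i.e. d_{n−1}(x) ∈ {1,2}. Then f(y) → f(x) as y → x from the right, and as y → x from the left f(y) tends to f(x) − 1/(2·3^{n−1}) if d_{n−1}(x) = 1, and to f(x) + 1/(2·3^{n−1}) if d_{n−1}(x) = 2; in particular the jump (right limit minus left limit) equals 1/(2·3^{n−1}) when d_{n−1}(x) = 1 and −1/(2·3^{n−1}) when d_{n−1}(x) = 2. -/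
open Filter Topology

lemma phi_emod_three_abs_le (k : ℤ) : |phi (k % 3)| ≤ 2 := by
  have h : k % 3 = 0 ∨ k % 3 = 1 ∨ k % 3 = 2 := by omega
  rcases h with h | h | h <;> rw [h] <;> norm_num [phi]

lemma summable_const_div_three_pow_succ (c : ℝ) : Summable fun m : ℕ => c / (3:ℝ)^(m+1) := by
  have h : Summable fun m : ℕ => c / 3 * (1 / 3 : ℝ)^m :=
    (summable_geometric_of_lt_one (by norm_num) (by norm_num)).mul_left _
  refine h.congr fun m => ?_
  rw [one_div, inv_pow, pow_succ]
  field_simp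

lemma norm_phi_emod_three_div_le (k : ℤ) (m : ℕ) :
    ‖phi (k % 3) / (3:ℝ)^(m+1)‖ ≤ 2 / (3:ℝ)^(m+1) := by
  rw [norm_div, Real.norm_eq_abs, Real.norm_of_nonneg (by positivity : (0:ℝ) ≤ 3^(m+1))]
  gcongr
  exact phi_emod_three_abs_le k

lemma summable_phi_emod_three (e : ℕ → ℤ) :
    Summable fun m : ℕ => phi (e m % 3) / (3:ℝ)^(m+1) :=
  .of_norm_bounded (summable_const_div_three_pow_succ 2) fun m =>
    norm_phi_emod_three_div_le (e m) m

/-- If every ternary digit is eventually constant along `l`, then `f` converges along `l`. -/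
lemma tendsto_f_of_eventually_terDigit_eq {l : Filter ℝ} {e : ℕ → ℤ}
    (h : ∀ m, ∀ᶠ y in l, terDigit m y = e m) :
    Tendsto f l (𝓝 (∑' m : ℕ, phi (e m) / (3:ℝ)^(m+1))) := by
  refine tendsto_tsum_of_dominated_convergence (summable_const_div_three_pow_succ 2)
    (fun m => ?_) (.of_forall fun y m => norm_phi_emod_three_div_le _ m)
  refine tendsto_const_nhds.congr' ?_
  filter_upwards [h m] with y hy
  rw [hy]

lemma eventually_terDigit_eq_right (m : ℕ) (x : ℝ) :
    ∀ᶠ y in 𝓝[>] x, terDigit m y = terDigit m x := by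
  have hc : Tendsto (fun y : ℝ => (3:ℝ)^(m+1) * y) (𝓝[>] x) (𝓝 ((3:ℝ)^(m+1) * x)) :=
    ((continuous_const.mul continuous_id).tendsto x).mono_left nhdsWithin_le_nhds
  filter_upwards [hc.eventually_lt_const (Int.lt_floor_add_one _), self_mem_nhdsWithin]
    with y hy hxy
  have hle : (3:ℝ)^(m+1) * x ≤ 3^(m+1) * y := by gcongr; exact le_of_lt hxy
  rw [terDigit, terDigit, Int.floor_eq_iff.2 ⟨(Int.floor_le _).trans hle, hy⟩]

lemma eventually_terDigit_eq_left (m : ℕ) (x : ℝ) :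
    ∀ᶠ y in 𝓝[<] x, terDigit m y = (⌈(3:ℝ)^(m+1) * x⌉ - 1) % 3 := by
  have hc : Tendsto (fun y : ℝ => (3:ℝ)^(m+1) * y) (𝓝[<] x) (𝓝 ((3:ℝ)^(m+1) * x)) :=
    ((continuous_const.mul continuous_id).tendsto x).mono_left nhdsWithin_le_nhds
  have hlt : ((⌈(3:ℝ)^(m+1) * x⌉ - 1 : ℤ) : ℝ) < 3^(m+1) * x := by
    push_cast
    linarith [Int.ceil_lt_add_one ((3:ℝ)^(m+1) * x)]
  filter_upwards [hc.eventually_const_lt hlt, self_mem_nhdsWithin] with y hy hyx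
  have hlt' : (3:ℝ)^(m+1) * y < 3^(m+1) * x := by
    have : y < x := hyx
    gcongr
  rw [terDigit, Int.floor_eq_iff.2 ⟨hy.le, ?_⟩]
  push_cast
  linarith [Int.le_ceil ((3:ℝ)^(m+1) * x)]

/-- The left limit of `f` at a ternary rational whose last nonzero digit is at position `p`. -/
lemma tendsto_f_left_of_terDigit_ne_zero {p : ℕ} {x : ℝ} {k : ℤ}
    (hk : (3:ℝ)^(p+1) * x = k) (hd : terDigit p x ≠ 0) :
    Tendsto f (𝓝[<] x) (𝓝 (f x +
      ((phi (terDigit p x - 1) - phi (terDigit p x)) / 3^(p+1) + 1 / (2 * 3^(p+1))))) := by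
  have hdk : terDigit p x = k % 3 := by rw [terDigit, hk, Int.floor_intCast]
  convert tendsto_f_of_eventually_terDigit_eq fun m => eventually_terDigit_eq_left m x using 2
  have hs := summable_phi_emod_three fun m => ⌈(3:ℝ)^(m+1) * x⌉ - 1
  have hs' : Summable fun m => phi (terDigit m x) / (3:ℝ)^(m+1) :=
    summable_phi_emod_three fun m => ⌊(3:ℝ)^(m+1) * x⌋
  rw [← eq_sub_iff_add_eq']
  rw [f, ← hs.tsum_sub hs', ← (hs.sub hs').sum_add_tsum_nat_add (p+1), Finset.sum_range_succ,
    Finset.sum_eq_zero, zero_add]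
  · congr 1
    · rw [hdk, hk, Int.ceil_intCast, show (k - 1) % 3 = k % 3 - 1 by omega]
      ring
    · have hterm : ∀ i : ℕ, phi ((⌈(3:ℝ)^(i + (p+1) + 1) * x⌉ - 1) % 3) / 3^(i + (p+1) + 1)
          - phi (terDigit (i + (p+1)) x) / 3^(i + (p+1) + 1)
          = 1 / (3 * 3^(p+1)) * (1/3 : ℝ)^i := by
        intro i
        have hi : (3:ℝ)^(i + (p+1) + 1) * x = ((3 * (3^i * k) : ℤ) : ℝ) := by
          push_cast
          rw [← hk]
          ring
        rw [terDigit, hi, Int.ceil_intCast, Int.floor_intCast,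
          show (3 * (3^i * k) - 1) % 3 = 2 by omega, show (3 * (3^i * k)) % 3 = 0 by omega]
        rw [one_div_pow]
        norm_num [phi]
        ring
      rw [tsum_congr hterm, tsum_mul_left, tsum_geometric_of_lt_one (by norm_num) (by norm_num)]
      field_simp
      norm_num
  · intro m hm
    obtain ⟨j, rfl⟩ := Nat.exists_eq_add_of_lt (Finset.mem_range.1 hm)
    suffices h : ⌈(3:ℝ)^(m+1) * x⌉ - 1 = ⌊(3:ℝ)^(m+1) * x⌋ by rw [h, terDigit, sub_self]
    have hne : (⌊(3:ℝ)^(m+1) * x⌋ : ℝ) ≠ 3^(m+1) * x := by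
      intro h
      apply hd
      have hk' : k = 3 * (3^j * ⌊(3:ℝ)^(m+1) * x⌋) := by
        have : (k : ℝ) = ((3 * (3^j * ⌊(3:ℝ)^(m+1) * x⌋) : ℤ) : ℝ) := by
          push_cast
          rw [h, ← hk]
          ring
        exact_mod_cast this
      rw [hdk, hk', Int.mul_emod_right]
    have hlt := lt_of_le_of_ne (Int.floor_le ((3:ℝ)^(m+1) * x)) hne
    have hceil : ⌈(3:ℝ)^(m+1) * x⌉ = ⌊(3:ℝ)^(m+1) * x⌋ + 1 := by
      rw [Int.ceil_eq_iff]
      push_cast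
      exact ⟨by linarith, (Int.lt_floor_add_one _).le⟩
    omega

theorem stmt_14 (n : ℕ) (hn : 1 ≤ n) (x : ℝ) (hx : x ∈ Set.Ioo (0:ℝ) 1)
    (hrat : ∃ k : ℤ, (3:ℝ)^n * x = (k:ℝ))
    (hlast : terDigit (n-1) x = 1 ∨ terDigit (n-1) x = 2) :
    Filter.Tendsto f (nhdsWithin x (Set.Ioi x)) (nhds (f x)) ∧
    (terDigit (n-1) x = 1 →
      Filter.Tendsto f (nhdsWithin x (Set.Iio x)) (nhds (f x - 1/(2 * 3^(n-1))))) ∧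
    (terDigit (n-1) x = 2 →
      Filter.Tendsto f (nhdsWithin x (Set.Iio x)) (nhds (f x + 1/(2 * 3^(n-1))))) := by
  obtain ⟨p, rfl⟩ : ∃ p, n = p + 1 := ⟨n - 1, by omega⟩
  obtain ⟨k, hk⟩ := hrat
  rw [Nat.add_sub_cancel] at hlast ⊢
  have hleft := tendsto_f_left_of_terDigit_ne_zero hk (by omega)
  refine ⟨tendsto_f_of_eventually_terDigit_eq fun m => eventually_terDigit_eq_right m x,
    fun h => ?_, fun h => ?_⟩ <;>
  · rw [h] at hleft
    convert hleft using 2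
    norm_num [phi]
    field_simp
    ring
end
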